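/- Theorem 1(a). Suppose the prior measure μ has a density p : E → ℝ with respect to the Lebesgue (volume) measure on E that is positive everywhere (a non-degenerate prior on ℝⁿ). Then for every σ_t > 0 and every z ∈ E there exists a regularizer h : E → EReal (taking values in ℝ ∪ {+∞}), which may depend on σ_t and z, such that for every w ∈ F the conditional MMSE denoiser D(z, w) is a minimizer over E of the composite objective x ↦ (1/2) · ‖A x − w‖² + h(x); i.e., D_{θ*}(x_t, y) = argmin_x { (1/2)‖A x − y‖² + h_t(x) }. -/

import Mathlib

open MeasureTheory

/-- Isotropic Gaussian density with standard deviation `σ` on `EuclideanSpace ℝ (Fin n)`. -/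
noncomputable def gaussDens (n : ℕ) (σ : ℝ) (u : EuclideanSpace ℝ (Fin n)) : ℝ :=
  (2 * Real.pi * σ ^ 2) ^ (-(n : ℝ) / 2) * Real.exp (-‖u‖ ^ 2 / (2 * σ ^ 2))

/-- The conditional MMSE denoiser `D(z, w) = E[x ∣ x_t = z, y = w]` for measurement operator
`A`, measurement noise level `σy`, diffusion noise level `σt`, and prior `μ`. -/
noncomputable def denoiser (n m : ℕ) (σt σy : ℝ)
    (A : EuclideanSpace ℝ (Fin n) →L[ℝ] EuclideanSpace ℝ (Fin m))
    (μ : Measure (EuclideanSpace ℝ (Fin n)))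
    (z : EuclideanSpace ℝ (Fin n)) (w : EuclideanSpace ℝ (Fin m)) :
    EuclideanSpace ℝ (Fin n) :=
  (∫ x, gaussDens n σt (z - x) * gaussDens m σy (w - A x) ∂μ)⁻¹
    • ∫ x, (gaussDens n σt (z - x) * gaussDens m σy (w - A x)) • x ∂μ

lemma gaussDens_pos (n : ℕ) {σ : ℝ} (hσ : 0 < σ) (u : EuclideanSpace ℝ (Fin n)) :
    0 < gaussDens n σ u := by
  unfold gaussDens
  have : 0 < 2 * Real.pi * σ ^ 2 := by positivity
  positivity

lemma gaussDens_continuous (n : ℕ) (σ : ℝ) : Continuous (gaussDens n σ) := by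
  unfold gaussDens
  fun_prop

lemma gaussDens_le (n : ℕ) {σ : ℝ} (hσ : 0 < σ) (u : EuclideanSpace ℝ (Fin n)) :
    gaussDens n σ u ≤ (2 * Real.pi * σ ^ 2) ^ (-(n : ℝ) / 2) := by
  unfold gaussDens
  have h0 : 0 < 2 * Real.pi * σ ^ 2 := by positivity
  have h1 : (0:ℝ) ≤ (2 * Real.pi * σ ^ 2) ^ (-(n : ℝ) / 2) := by positivity
  have h2 : Real.exp (-‖u‖ ^ 2 / (2 * σ ^ 2)) ≤ 1 := by
    rw [Real.exp_le_one_iff, neg_div]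
    have : 0 ≤ ‖u‖ ^ 2 / (2 * σ ^ 2) := by positivity
    linarith
  nlinarith

/-- `‖u‖` times the Gaussian density is bounded. -/
lemma gaussDens_mul_norm_le (n : ℕ) {σ : ℝ} (hσ : 0 < σ) (u : EuclideanSpace ℝ (Fin n)) :
    gaussDens n σ u * ‖u‖ ≤ (2 * Real.pi * σ ^ 2) ^ (-(n : ℝ) / 2) * (1 + 2 * σ ^ 2) := by
  unfold gaussDens
  have h0 : 0 < 2 * Real.pi * σ ^ 2 := by positivity
  have h1 : (0:ℝ) ≤ (2 * Real.pi * σ ^ 2) ^ (-(n : ℝ) / 2) := by positivity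
  rw [mul_assoc]
  refine mul_le_mul_of_nonneg_left ?_ h1
  set t : ℝ := ‖u‖ ^ 2 / (2 * σ ^ 2) with ht
  have hs : 0 < 2 * σ ^ 2 := by positivity
  have ht0 : 0 ≤ t := by positivity
  have hu : ‖u‖ ^ 2 = t * (2 * σ ^ 2) := by rw [ht]; field_simp
  have e1 : Real.exp (-t) * Real.exp t = 1 := by rw [← Real.exp_add]; simp
  have e2 : t + 1 ≤ Real.exp t := Real.add_one_le_exp t
  have e3 : 0 < Real.exp (-t) := Real.exp_pos _
  have hn : ‖u‖ ≤ (1 + 2 * σ ^ 2) * (t + 1) := by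
    nlinarith [sq_nonneg (‖u‖ - 1), norm_nonneg u]
  rw [neg_div, ← ht]
  calc Real.exp (-t) * ‖u‖ ≤ Real.exp (-t) * ((1 + 2 * σ ^ 2) * Real.exp t) := by
        refine mul_le_mul_of_nonneg_left (hn.trans ?_) e3.le
        exact mul_le_mul_of_nonneg_left e2 (by positivity)
    _ = (1 + 2 * σ ^ 2) * (Real.exp (-t) * Real.exp t) := by ring
    _ = 1 + 2 * σ ^ 2 := by rw [e1, mul_one]

section Weight

variable {n m : ℕ} {σt σy : ℝ}
  (A : EuclideanSpace ℝ (Fin n) →L[ℝ] EuclideanSpace ℝ (Fin m))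
  (μ : Measure (EuclideanSpace ℝ (Fin n))) [IsProbabilityMeasure μ]
  (z : EuclideanSpace ℝ (Fin n)) (w : EuclideanSpace ℝ (Fin m))

lemma weight_continuous (σt σy : ℝ) :
    Continuous fun x => gaussDens n σt (z - x) * gaussDens m σy (w - A x) := by
  have h1 := gaussDens_continuous n σt
  have h2 := gaussDens_continuous m σy
  exact (h1.comp (by fun_prop)).mul (h2.comp (by fun_prop))

lemma weight_pos (ht : 0 < σt) (hy : 0 < σy) (x : EuclideanSpace ℝ (Fin n)) :
    0 < gaussDens n σt (z - x) * gaussDens m σy (w - A x) :=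
  mul_pos (gaussDens_pos n ht _) (gaussDens_pos m hy _)

lemma weight_integrable (ht : 0 < σt) (hy : 0 < σy) :
    Integrable (fun x => gaussDens n σt (z - x) * gaussDens m σy (w - A x)) μ := by
  refine Integrable.of_bound (weight_continuous A z w σt σy).aestronglyMeasurable
    ((2 * Real.pi * σt ^ 2) ^ (-(n : ℝ) / 2) * (2 * Real.pi * σy ^ 2) ^ (-(m : ℝ) / 2)) ?_
  refine Filter.Eventually.of_forall fun x => ?_
  rw [Real.norm_of_nonneg (weight_pos A z w ht hy x).le]
  exact mul_le_mul (gaussDens_le n ht _) (gaussDens_le m hy _) (gaussDens_pos m hy _).le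
    ((gaussDens_pos n ht (z - x)).le.trans (gaussDens_le n ht _))

lemma weight_smul_integrable (ht : 0 < σt) (hy : 0 < σy) :
    Integrable (fun x => (gaussDens n σt (z - x) * gaussDens m σy (w - A x)) • x) μ := by
  set c := (2 * Real.pi * σt ^ 2) ^ (-(n : ℝ) / 2)
  set d := (2 * Real.pi * σy ^ 2) ^ (-(m : ℝ) / 2)
  refine Integrable.of_bound
    ((weight_continuous A z w σt σy).smul continuous_id).aestronglyMeasurable
    ((c * (1 + 2 * σt ^ 2) + c * ‖z‖) * d) ?_
  refine Filter.Eventually.of_forall fun x => ?_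
  rw [norm_smul, Real.norm_of_nonneg (weight_pos A z w ht hy x).le]
  have g0 := (gaussDens_pos n ht (z - x)).le
  have hx : ‖x‖ ≤ ‖z - x‖ + ‖z‖ := by
    have := norm_sub_le z (z - x)
    simp only [sub_sub_cancel] at this
    linarith
  have h1 : gaussDens n σt (z - x) * ‖x‖ ≤ c * (1 + 2 * σt ^ 2) + c * ‖z‖ := by
    have a1 := mul_le_mul_of_nonneg_left hx g0
    have a2 := gaussDens_mul_norm_le n ht (z - x)
    have a3 := mul_le_mul_of_nonneg_right (gaussDens_le n ht (z - x)) (norm_nonneg z)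
    rw [mul_add] at a1
    exact a1.trans (add_le_add a2 a3)
  have h2 : 0 ≤ gaussDens n σt (z - x) * ‖x‖ := mul_nonneg g0 (norm_nonneg _)
  calc _ = (gaussDens n σt (z - x) * ‖x‖) * gaussDens m σy (w - A x) := by ring
    _ ≤ _ := mul_le_mul h1 (gaussDens_le m hy _) (gaussDens_pos m hy _).le (h2.trans h1)

/-- The evidence `Z(w)` is positive. -/
lemma evidence_pos (ht : 0 < σt) (hy : 0 < σy) :
    0 < ∫ x, gaussDens n σt (z - x) * gaussDens m σy (w - A x) ∂μ := by
  rw [integral_pos_iff_support_of_nonneg (fun x => (weight_pos A z w ht hy x).le)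
    (weight_integrable A μ z w ht hy)]
  have : (Function.support fun x => gaussDens n σt (z - x) * gaussDens m σy (w - A x))
      = Set.univ := by
    ext x
    simpa using (weight_pos A z w ht hy x).ne'
  rw [this]
  simp

/-- Jensen-type inequality: the log-evidence lies above its tangent parabola. -/
lemma evidence_ineq (ht : 0 < σt) (hy : 0 < σy) (w' : EuclideanSpace ℝ (Fin m)) :
    Real.exp ((‖A (denoiser n m σt σy A μ z w) - w‖ ^ 2
        - ‖A (denoiser n m σt σy A μ z w) - w'‖ ^ 2) / (2 * σy ^ 2))
      * (∫ x, gaussDens n σt (z - x) * gaussDens m σy (w - A x) ∂μ)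
    ≤ ∫ x, gaussDens n σt (z - x) * gaussDens m σy (w' - A x) ∂μ := by
  set D := denoiser n m σt σy A μ z w with hD
  set G : EuclideanSpace ℝ (Fin n) → ℝ :=
    fun x => gaussDens n σt (z - x) * gaussDens m σy (w - A x) with hG
  have hGi : Integrable G μ := weight_integrable A μ z w ht hy
  have hGs : Integrable (fun x => G x • x) μ := weight_smul_integrable A μ z w ht hy
  have hZ : 0 < ∫ x, G x ∂μ := evidence_pos A μ z w ht hy
  have hs : 0 < σy ^ 2 := by positivity
  -- the affine exponent
  let T : EuclideanSpace ℝ (Fin n) →L[ℝ] ℝ := (innerSL ℝ (w' - w)).comp A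
  let l : EuclideanSpace ℝ (Fin n) → ℝ :=
    fun x => (‖A x - w‖ ^ 2 - ‖A x - w'‖ ^ 2) / (2 * σy ^ 2)
  have hl : ∀ x y, l x - l y = T (x - y) / σy ^ 2 := by
    intro x y
    have hT : T (x - y) = inner ℝ (A x) w' - inner ℝ (A x) w
        - (inner ℝ (A y) w' - inner ℝ (A y) w) := by
      change inner ℝ (w' - w) (A (x - y)) = _
      rw [map_sub, real_inner_comm, inner_sub_left, inner_sub_right, inner_sub_right]
    simp only [l]
    rw [hT, norm_sub_sq_real, norm_sub_sq_real, norm_sub_sq_real, norm_sub_sq_real]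
    field_simp
    ring
  have hG' : ∀ x, gaussDens n σt (z - x) * gaussDens m σy (w' - A x) = G x * Real.exp (l x) := by
    intro x
    have e : Real.exp (-‖w' - A x‖ ^ 2 / (2 * σy ^ 2))
        = Real.exp (-‖w - A x‖ ^ 2 / (2 * σy ^ 2)) * Real.exp (l x) := by
      rw [← Real.exp_add, norm_sub_rev w' (A x), norm_sub_rev w (A x)]
      congr 1
      simp only [l]
      ring
    simp only [hG, gaussDens]
    rw [e]
    ring
  have hmean : ∫ x, G x • (x - D) ∂μ = 0 := by
    simp_rw [smul_sub]
    rw [integral_sub hGs (hGi.smul_const D), integral_smul_const, sub_eq_zero, hD, denoiser,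
      smul_smul, mul_inv_cancel₀ hZ.ne', one_smul]
  have hGc : Integrable (fun x => G x • (x - D)) μ := by
    simp_rw [smul_sub]
    exact hGs.sub (hGi.smul_const D)
  have hTi : Integrable (fun x => T (G x • (x - D))) μ := T.integrable_comp hGc
  have hT0 : ∫ x, T (G x • (x - D)) ∂μ = 0 := by
    rw [T.integral_comp_comm hGc, hmean, map_zero]
  have hlow : Integrable (fun x => Real.exp (l D) * (G x + T (G x • (x - D)) / σy ^ 2)) μ :=
    (hGi.add (hTi.div_const _)).const_mul _
  calc Real.exp (l D) * ∫ x, G x ∂μ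
      = ∫ x, Real.exp (l D) * (G x + T (G x • (x - D)) / σy ^ 2) ∂μ := by
        rw [integral_const_mul, integral_add hGi (hTi.div_const _), integral_div, hT0]
        simp
    _ ≤ _ := by
        refine integral_mono hlow (weight_integrable A μ z w' ht hy) fun x => ?_
        simp only
        rw [hG' x, map_smul, smul_eq_mul, mul_div_assoc, ← hl]
        have e : Real.exp (l x) = Real.exp (l D) * Real.exp (l x - l D) := by
          rw [← Real.exp_add]; congr 1; ring
        have e2 := Real.add_one_le_exp (l x - l D)
        have g := weight_pos A z w ht hy x
        rw [e]
        have := mul_le_mul_of_nonneg_left e2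
          (mul_pos (Real.exp_pos (l D)) g).le
        simp only [hG] at this ⊢
        linarith

end Weight

/-- Strong form of Theorem 1(a): the regularizer can moreover be chosen to be finite at every
denoiser output (so it is proper, and the minimum is a genuine finite minimum). -/
theorem denoiser_is_composite_minimizer_proper (n m : ℕ)
    (A : EuclideanSpace ℝ (Fin n) →L[ℝ] EuclideanSpace ℝ (Fin m))
    (σy : ℝ) (hy : 0 < σy)
    (μ : Measure (EuclideanSpace ℝ (Fin n))) [IsProbabilityMeasure μ]
    (σt : ℝ) (ht : 0 < σt) (z : EuclideanSpace ℝ (Fin n)) :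
      ∃ h : EuclideanSpace ℝ (Fin n) → EReal,
        (∀ x, h x ≠ ⊥) ∧ (∀ w, h (denoiser n m σt σy A μ z w) ≠ ⊤) ∧
        ∀ w : EuclideanSpace ℝ (Fin m), ∀ x : EuclideanSpace ℝ (Fin n),
          (((1 / 2 : ℝ) * ‖A (denoiser n m σt σy A μ z w) - w‖ ^ 2 : ℝ) : EReal)
              + h (denoiser n m σt σy A μ z w)
            ≤ (((1 / 2 : ℝ) * ‖A x - w‖ ^ 2 : ℝ) : EReal) + h x := by
  let L : EuclideanSpace ℝ (Fin m) → ℝ := fun w =>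
    Real.log (∫ x, gaussDens n σt (z - x) * gaussDens m σy (w - A x) ∂μ)
  let h : EuclideanSpace ℝ (Fin n) → EReal := fun x =>
    ⨆ w : EuclideanSpace ℝ (Fin m), ((-(σy ^ 2 * L w) - 1 / 2 * ‖A x - w‖ ^ 2 : ℝ) : EReal)
  have hle : ∀ x w, ((-(σy ^ 2 * L w) - 1 / 2 * ‖A x - w‖ ^ 2 : ℝ) : EReal) ≤ h x :=
    fun x w => le_iSup (fun w => ((-(σy ^ 2 * L w) - 1 / 2 * ‖A x - w‖ ^ 2 : ℝ) : EReal)) w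
  have hub : ∀ w, h (denoiser n m σt σy A μ z w) ≤
      ((-(σy ^ 2 * L w) - 1 / 2 * ‖A (denoiser n m σt σy A μ z w) - w‖ ^ 2 : ℝ) : EReal) := by
    intro w
    refine iSup_le fun w' => ?_
    rw [EReal.coe_le_coe_iff]
    have hZ := evidence_pos A μ z w ht hy
    have key := Real.log_le_log (mul_pos (Real.exp_pos _) hZ) (evidence_ineq A μ z w ht hy w')
    rw [Real.log_mul (Real.exp_pos _).ne' hZ.ne', Real.log_exp] at key
    change _ + L w ≤ L w' at key
    have hs : 0 < σy ^ 2 := by positivity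
    have k2 := mul_le_mul_of_nonneg_left key hs.le
    have e : ∀ a b : ℝ, σy ^ 2 * (a / (2 * σy ^ 2) + b) = a / 2 + σy ^ 2 * b := by
      intro a b
      field_simp
    rw [e] at k2
    linarith
  refine ⟨h, fun x hx => ?_, fun w hw => ?_, fun w x => ?_⟩
  · have := hle x 0
    rw [hx, le_bot_iff] at this
    exact EReal.coe_ne_bot _ this
  · have := hub w
    rw [hw, top_le_iff] at this
    exact EReal.coe_ne_top _ this
  · refine (add_le_add le_rfl (hub w)).trans (le_trans (le_of_eq ?_) (add_le_add le_rfl (hle x w)))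
    rw [← EReal.coe_add, ← EReal.coe_add]
    congr 1
    ring

/-- Theorem 1(a): for a non-degenerate prior, for every `σ_t > 0` and every `z` there is a
regularizer `h : E → ℝ ∪ {+∞}` such that for every measurement `w` the conditional MMSE
denoiser `D(z, w)` minimizes the composite objective `x ↦ (1/2)‖A x − w‖² + h(x)`. -/
theorem denoiser_is_composite_minimizer (n m : ℕ) (hn : 0 < n) (hm : 0 < m)
    (A : EuclideanSpace ℝ (Fin n) →L[ℝ] EuclideanSpace ℝ (Fin m))
    (σy : ℝ) (hσy : 0 < σy)
    (p : EuclideanSpace ℝ (Fin n) → ℝ) (hp : Measurable p) (hppos : ∀ x, 0 < p x)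
    (μ : Measure (EuclideanSpace ℝ (Fin n))) [IsProbabilityMeasure μ]
    (hμ : μ = volume.withDensity fun x => ENNReal.ofReal (p x)) :
    ∀ σt : ℝ, 0 < σt → ∀ z : EuclideanSpace ℝ (Fin n),
      ∃ h : EuclideanSpace ℝ (Fin n) → EReal,
        (∀ x, h x ≠ ⊥) ∧
        ∀ w : EuclideanSpace ℝ (Fin m), ∀ x : EuclideanSpace ℝ (Fin n),
          (((1 / 2 : ℝ) * ‖A (denoiser n m σt σy A μ z w) - w‖ ^ 2 : ℝ) : EReal)
              + h (denoiser n m σt σy A μ z w)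
            ≤ (((1 / 2 : ℝ) * ‖A x - w‖ ^ 2 : ℝ) : EReal) + h x := by
  intro σt ht z
  obtain ⟨h, h1, -, h3⟩ := denoiser_is_composite_minimizer_proper n m A σy hσy μ σt ht z
  exact ⟨h, h1, h3⟩
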